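/- Let f : S → Bool be any function assigning to each encoder state its most recent input bit (so that the information bit at time t is b_t = f(S_t)). Define the serial BCJR decision b̂_t = 0 if P(f(S_t) = 0 | Y = y) ≥ 1/2 and b̂_t = 1 otherwise, and the parallel BCJR decision b̂_t^{i(t)} = 0 if P(f(S_t) = 0 | Y_{i(t)} = y|_{i(t)}) ≥ 1/2 and b̂_t^{i(t)} = 1 otherwise. Then for every t ∈ {1,…,L} and every observation sequence y with P(Y = y) > 0, the serial and parallel decisions coincide: b̂_t = b̂_t^{i(t)}. -/

import Mathlib

/-!
Finite hidden Markov source over a memoryless channel.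
States `S` (with distinguished state `0`), channel output symbols `O`.
A state path is `s : Fin (L+1) → S`; an observation sequence is `y : Fin L → O`,
where index `t : Fin L` represents time `t+1 ∈ {1,…,L}`.
-/

open scoped Classical in
/-- The probability of an event `A` under the mass function `P`. -/
noncomputable def prob {S O : Type*} [Fintype S] [Fintype O] {L : ℕ}
    (P : (Fin (L + 1) → S) × (Fin L → O) → ℝ)
    (A : (Fin (L + 1) → S) × (Fin L → O) → Prop) : ℝ :=
  ∑ sy : (Fin (L + 1) → S) × (Fin L → O), if A sy then P sy else 0

/-- The conditional probability `P(A | B)`. -/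
noncomputable def condProb {S O : Type*} [Fintype S] [Fintype O] {L : ℕ}
    (P : (Fin (L + 1) → S) × (Fin L → O) → ℝ)
    (A B : (Fin (L + 1) → S) × (Fin L → O) → Prop) : ℝ :=
  prob P (fun sy => A sy ∧ B sy) / prob P B

/-- The path and observations that follow `ω` at the times in `(a, b]` and `ω'` elsewhere. -/
def splice {S O : Type*} {L : ℕ} (a b : ℕ) (ω ω' : (Fin (L + 1) → S) × (Fin L → O)) :
    (Fin (L + 1) → S) × (Fin L → O) :=
  (fun j => if a < (j : ℕ) ∧ (j : ℕ) ≤ b then ω.1 j else ω'.1 j,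
    fun k => if a < (k : ℕ) + 1 ∧ (k : ℕ) + 1 ≤ b then ω.2 k else ω'.2 k)

lemma splice_splice {S O : Type*} {L : ℕ} (a b : ℕ)
    (ω ω' : (Fin (L + 1) → S) × (Fin L → O)) :
    splice a b (splice a b ω ω') (splice a b ω' ω) = ω := by
  ext j <;> simp only [splice] <;> split_ifs <;> rfl

/-- Exchanging the behaviour of two sample points on the times in `(a, b]`. -/
def exchange {S O : Type*} {L : ℕ} (a b : ℕ)
    (x : ((Fin (L + 1) → S) × (Fin L → O)) × ((Fin (L + 1) → S) × (Fin L → O))) :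
    ((Fin (L + 1) → S) × (Fin L → O)) × ((Fin (L + 1) → S) × (Fin L → O)) :=
  (splice a b x.1 x.2, splice a b x.2 x.1)

lemma exchange_involutive {S O : Type*} {L : ℕ} (a b : ℕ) :
    Function.Involutive (exchange a b : ((Fin (L + 1) → S) × (Fin L → O)) ×
      ((Fin (L + 1) → S) × (Fin L → O)) → _) := fun x =>
  Prod.ext (splice_splice a b x.1 x.2) (splice_splice a b x.2 x.1)

lemma prob_mul_prob_eq_of_involutive {S O : Type*} [Fintype S] [Fintype O] {L : ℕ}
    {P : (Fin (L + 1) → S) × (Fin L → O) → ℝ}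
    {A B A' B' : (Fin (L + 1) → S) × (Fin L → O) → Prop}
    {e : ((Fin (L + 1) → S) × (Fin L → O)) × ((Fin (L + 1) → S) × (Fin L → O)) →
      ((Fin (L + 1) → S) × (Fin L → O)) × ((Fin (L + 1) → S) × (Fin L → O))}
    (he : Function.Involutive e)
    (heP : ∀ x, P (e x).1 * P (e x).2 = P x.1 * P x.2)
    (hAB : ∀ x, A x.1 ∧ B x.2 ↔ A' (e x).1 ∧ B' (e x).2) :
    prob P A * prob P B = prob P A' * prob P B' := by
  classical
  simp only [prob, Finset.sum_mul_sum, ← Fintype.sum_prod_type']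
  refine Fintype.sum_equiv he.toPerm _ _ fun x => ?_
  rw [he.coe_toPerm, ite_zero_mul_ite_zero, ite_zero_mul_ite_zero, heP]
  exact if_congr (hAB x) rfl rfl

lemma prob_mono {S O : Type*} [Fintype S] [Fintype O] {L : ℕ}
    {P : (Fin (L + 1) → S) × (Fin L → O) → ℝ} (hP : ∀ ω, 0 ≤ P ω)
    {A B : (Fin (L + 1) → S) × (Fin L → O) → Prop} (hAB : ∀ ω, A ω → B ω) :
    prob P A ≤ prob P B := by
  refine Finset.sum_le_sum fun ω _ => ?_
  by_cases hA : A ω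
  · simp [hA, hAB ω hA]
  · rw [if_neg hA]
    split_ifs
    exacts [hP ω, le_rfl]

/-- The Markov weight of two sample points in the same states at times `a` and `b` is unchanged
by exchanging them on `(a, b]`. -/
lemma weight_splice_mul_weight_splice {S O : Type*} {L : ℕ} (a b : Fin (L + 1))
    (c : S → ℝ) (g : O → S → S → ℝ) (ω ω' : (Fin (L + 1) → S) × (Fin L → O))
    (ha : ω.1 a = ω'.1 a) (hb : ω.1 b = ω'.1 b) :
    (c ((splice a b ω ω').1 0) * ∏ k : Fin L, g ((splice a b ω ω').2 k)
        ((splice a b ω ω').1 k.castSucc) ((splice a b ω ω').1 k.succ)) *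
      (c ((splice a b ω' ω).1 0) * ∏ k : Fin L, g ((splice a b ω' ω).2 k)
        ((splice a b ω' ω).1 k.castSucc) ((splice a b ω' ω).1 k.succ)) =
    (c (ω.1 0) * ∏ k : Fin L, g (ω.2 k) (ω.1 k.castSucc) (ω.1 k.succ)) *
      (c (ω'.1 0) * ∏ k : Fin L, g (ω'.2 k) (ω'.1 k.castSucc) (ω'.1 k.succ)) := by
  have factor : ∀ ω ω' : (Fin (L + 1) → S) × (Fin L → O), ω.1 a = ω'.1 a → ω.1 b = ω'.1 b →
      ∀ k : Fin L, g ((splice a b ω ω').2 k)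
        ((splice a b ω ω').1 k.castSucc) ((splice a b ω ω').1 k.succ) =
      if (a : ℕ) < (k : ℕ) + 1 ∧ (k : ℕ) + 1 ≤ b then g (ω.2 k) (ω.1 k.castSucc) (ω.1 k.succ)
      else g (ω'.2 k) (ω'.1 k.castSucc) (ω'.1 k.succ) := by
    intro ω ω' ha hb k
    have hka : (k : ℕ) = a → ω.1 k.castSucc = ω'.1 k.castSucc := fun h => by
      rw [show k.castSucc = a from Fin.ext h, ha]
    have hkb : (k : ℕ) = b → ω.1 k.castSucc = ω'.1 k.castSucc := fun h => by
      rw [show k.castSucc = b from Fin.ext h, hb]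
    simp only [splice, Fin.val_castSucc, Fin.val_succ]
    split_ifs with h₁ h₂ h₂
    · rfl
    · rw [hka (by omega)]
    · rw [hkb (by omega)]
    · rfl
  have init : ∀ ω ω' : (Fin (L + 1) → S) × (Fin L → O), (splice a b ω ω').1 0 = ω'.1 0 :=
    fun ω ω' => by simp [splice]
  simp only [factor ω ω' ha hb, factor ω' ω ha.symm hb.symm, init]
  rw [mul_mul_mul_comm, ← Finset.prod_mul_distrib, mul_mul_mul_comm (c (ω.1 0)),
    ← Finset.prod_mul_distrib, mul_comm (c (ω'.1 0))]
  congr 1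
  refine Finset.prod_congr rfl fun k _ => ?_
  split_ifs
  · rfl
  · exact mul_comm _ _

/-- **Serial and parallel BCJR decisions for the information bits coincide.**
The decision is `false` (the bit 0) if the a-posteriori probability of the bit
being 0 is at least 1/2, and `true` (the bit 1) otherwise. -/
theorem serial_parallel_BCJR_decision_info_bits
    {S O : Type*} [Fintype S] [Fintype O] [Nonempty S] [Nonempty O]
    [Zero S] [DecidableEq S]
    {N L : ℕ} (hN : 1 ≤ N) (hL : 1 ≤ L)
    -- boundary times 0 = L_0 < L_1 < ⋯ < L_N = L
    (Lb : Fin (N + 1) → Fin (L + 1)) (hmono : StrictMono Lb)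
    (hLb0 : Lb 0 = 0) (hLbN : Lb (Fin.last N) = Fin.last L)
    -- the factorizing probability mass function
    (p : S → S → ℝ) (q : O → S → S → ℝ)
    (hp : ∀ a b, 0 ≤ p a b) (hq : ∀ o a b, 0 ≤ q o a b)
    (P : (Fin (L + 1) → S) × (Fin L → O) → ℝ)
    (hP : ∀ s y, P (s, y) =
      (if s 0 = 0 then (1 : ℝ) else 0) *
        ∏ t : Fin L, p (s t.castSucc) (s t.succ) * q (y t) (s t.castSucc) (s t.succ))
    (hsum : ∑ sy : (Fin (L + 1) → S) × (Fin L → O), P sy = 1)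
    -- termination: each parallel codeword drives the encoder back to state 0
    (hterm : ∀ s y, P (s, y) ≠ 0 → ∀ i : Fin (N + 1), s (Lb i) = 0)
    -- the input-bit map
    (f : S → Bool)
    -- the observation sequence, with positive serial probability
    (y : Fin L → O)
    (hy : 0 < prob P (fun sy => sy.2 = y))
    -- the time t (as an element of Fin L, representing time t+1) and its segment index
    (t : Fin L) (i : Fin N)
    (hti : ((Lb i.castSucc : ℕ) < (t : ℕ) + 1) ∧ ((t : ℕ) + 1 ≤ (Lb i.succ : ℕ))) :
    (if (1 : ℝ) / 2 ≤ condProb P (fun sy => f (sy.1 t.succ) = false) (fun sy => sy.2 = y)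
      then false else true) =
    (if (1 : ℝ) / 2 ≤ condProb P (fun sy => f (sy.1 t.succ) = false)
        (fun sy => ∀ k : Fin L,
          (Lb i.castSucc : ℕ) < (k : ℕ) + 1 → (k : ℕ) + 1 ≤ (Lb i.succ : ℕ) →
            sy.2 k = y k)
      then false else true) := by
  have hP0 : ∀ ω, 0 ≤ P ω := fun ω => by
    rw [← Prod.mk.eta (p := ω), hP]
    exact mul_nonneg (by split_ifs <;> norm_num)
      (Finset.prod_nonneg fun k _ => mul_nonneg (hp _ _) (hq _ _ _))
  set a := Lb i.castSucc
  set b := Lb i.succ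
  have exchange_of_ne : ∀ x, P x.1 * P x.2 ≠ 0 →
      P (exchange a b x).1 * P (exchange a b x).2 = P x.1 * P x.2 := by
    rintro ⟨ω, ω'⟩ hx
    have hω := hterm ω.1 ω.2 (left_ne_zero_of_mul hx)
    have hω' := hterm ω'.1 ω'.2 (right_ne_zero_of_mul hx)
    have hP' : ∀ ω, P ω = _ := fun ω => hP ω.1 ω.2
    simp only [hP', exchange]
    exact weight_splice_mul_weight_splice a b (fun s => if s = 0 then 1 else 0)
      (fun o s s' => p s s' * q o s s') ω ω' ((hω _).trans (hω' _).symm)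
      ((hω _).trans (hω' _).symm)
  have exchange_eq : ∀ x,
      P (exchange a b x).1 * P (exchange a b x).2 = P x.1 * P x.2 := by
    intro x
    by_cases hx : P x.1 * P x.2 = 0
    · by_contra hne
      have h := exchange_of_ne (exchange a b x) fun h => hne (h.trans hx.symm)
      rw [exchange_involutive] at h
      exact hne h.symm
    · exact exchange_of_ne x hx
  have hseg := hy.trans_le (prob_mono hP0 (B := fun sy => ∀ k : Fin L,
    (a : ℕ) < (k : ℕ) + 1 → (k : ℕ) + 1 ≤ (b : ℕ) → sy.2 k = y k)
    fun ω h k _ _ => congrFun h k)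
  congr 2
  rw [condProb, condProb, div_eq_div_iff hy.ne' hseg.ne']
  refine prob_mul_prob_eq_of_involutive (exchange_involutive a b) exchange_eq ?_
  rintro ⟨ω, ω'⟩
  have ht : (splice a b ω ω').1 t.succ = ω.1 t.succ := if_pos hti
  have hin : ∀ ω ω' : (Fin (L + 1) → S) × (Fin L → O), ∀ k : Fin L, (a : ℕ) < (k : ℕ) + 1 →
      (k : ℕ) + 1 ≤ b → (splice a b ω ω').2 k = ω.2 k := fun ω ω' k h₁ h₂ => if_pos ⟨h₁, h₂⟩
  have hout : ∀ ω ω' : (Fin (L + 1) → S) × (Fin L → O), ∀ k : Fin L, ¬ ((a : ℕ) < (k : ℕ) + 1 ∧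
      (k : ℕ) + 1 ≤ b) → (splice a b ω ω').2 k = ω'.2 k := fun ω ω' k h => if_neg h
  simp only [exchange, ht, funext_iff]
  constructor
  · rintro ⟨⟨hf, hω⟩, hω'⟩
    refine ⟨⟨hf, fun k h₁ h₂ => (hin _ _ k h₁ h₂).trans (hω k)⟩, fun k => ?_⟩
    by_cases h : (a : ℕ) < (k : ℕ) + 1 ∧ (k : ℕ) + 1 ≤ b
    · exact (hin _ _ k h.1 h.2).trans (hω' k h.1 h.2)
    · exact (hout _ _ k h).trans (hω k)
  · rintro ⟨⟨hf, hω⟩, hω'⟩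
    refine ⟨⟨hf, fun k => ?_⟩, fun k h₁ h₂ => (hin _ _ k h₁ h₂).symm.trans (hω' k)⟩
    by_cases h : (a : ℕ) < (k : ℕ) + 1 ∧ (k : ℕ) + 1 ≤ b
    · exact (hin _ _ k h.1 h.2).symm.trans (hω k h.1 h.2)
    · exact (hout _ _ k h).symm.trans (hω' k)
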